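/- Let 𝒜 be a countable nonempty alphabet and X ⊆ 𝒜^ℕ a subshift. Let Ω denote the closure in X_𝔽 of {ξ_x : x ∈ X}. Then the partial action of 𝔽 on Ω by left translation is minimal (i.e., for every ξ ∈ Ω the orbit {gξ : g ∈ 𝔽, g⁻¹ ∈ ξ} is dense in Ω) if and only if X is sequentially cofinal. -/

import Mathlib

/-! Basic subshift vocabulary. -/

/-- Concatenation of a finite word with an infinite sequence. -/
def wcat {A : Type*} (w : List A) (y : ℕ → A) : ℕ → A :=
  fun n => if h : n < w.length then w.get ⟨n, h⟩ else y (n - w.length)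

/-- `w` occurs as a (finite) factor of the sequence `x`. -/
def IsFactor {A : Type*} (w : List A) (x : ℕ → A) : Prop :=
  ∃ n : ℕ, ∀ i : Fin w.length, x (n + i) = w.get i

/-- The subshift `X_F ⊆ A^ℕ` determined by a set `F` of forbidden words. -/
def subshift {A : Type*} (Forb : Set (List A)) : Set (ℕ → A) :=
  {x | ∀ w ∈ Forb, ¬ IsFactor w x}

/-- The language of a set of sequences: all finite words (including the empty word)
occurring as factors of its elements. -/
def lang {A : Type*} (Xs : Set (ℕ → A)) : Set (List A) :=
  {w | w = [] ∨ ∃ x ∈ Xs, IsFactor w x}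

/-- `C(α, β) = {βx ∈ X : αx ∈ X}`. -/
def Cab {A : Type*} (Xs : Set (ℕ → A)) (α β : List A) : Set (ℕ → A) :=
  {z | ∃ y : ℕ → A, z = wcat β y ∧ wcat β y ∈ Xs ∧ wcat α y ∈ Xs}

/-- The element of the free group on `A` determined by a word over `A`. -/
def fgw {A : Type*} (w : List A) : FreeGroup A := (w.map FreeGroup.of).prod

/-- `ξ_x = {g ∈ 𝔽 : g = βα⁻¹ for some α, β ∈ L_X with x ∈ C(α,β)}`. -/
def xiSet {A : Type*} (Xs : Set (ℕ → A)) (x : ℕ → A) : Set (FreeGroup A) :=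
  {g | ∃ α ∈ lang Xs, ∃ β ∈ lang Xs, g = fgw β * (fgw α)⁻¹ ∧ x ∈ Cab Xs α β}

/-- `α` and `β` do not end in the same letter, i.e. `αβ⁻¹` is in reduced form. -/
def NoCommonLast {A : Type*} (α β : List A) : Prop :=
  ∀ a : A, α.getLast? = some a → β.getLast? ≠ some a

open Classical in
/-- The characteristic function of `ξ_x`, viewed as a point of the product space
`{0,1}^𝔽` (with `{0,1}` discrete). -/
noncomputable def xiB {A : Type*} (Xs : Set (ℕ → A)) (x : ℕ → A) : FreeGroup A → Bool :=
  fun g => if g ∈ xiSet Xs x then true else false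

/-- `Ω`: the closure in `X_𝔽 ⊆ {0,1}^𝔽` of `{ξ_x : x ∈ X}`. -/
noncomputable def Omega {A : Type*} (Xs : Set (ℕ → A)) : Set (FreeGroup A → Bool) :=
  closure {ξ | ∃ x ∈ Xs, ξ = xiB Xs x}

open Filter Topology

section Words

variable {A : Type*}

@[simp]
theorem wcat_nil (y : ℕ → A) : wcat [] y = y := by
  funext n; simp [wcat]

@[simp]
theorem wcat_cons_zero (a : A) (w : List A) (y : ℕ → A) : wcat (a :: w) y 0 = a := by
  simp [wcat]

@[simp]
theorem wcat_cons_succ (a : A) (w : List A) (y : ℕ → A) (n : ℕ) :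
    wcat (a :: w) y (n + 1) = wcat w y n := by
  simp [wcat]

theorem wcat_append (v w : List A) (y : ℕ → A) : wcat (v ++ w) y = wcat v (wcat w y) := by
  induction v with
  | nil => simp
  | cons a v ih =>
    funext n
    cases n with
    | zero => simp
    | succ n => simp [ih]

theorem wcat_of_length_le (w : List A) (y : ℕ → A) {n : ℕ} (h : w.length ≤ n) :
    wcat w y n = y (n - w.length) := by
  simp [wcat, not_lt.2 h]

theorem wcat_congr_left (w : List A) (y z : ℕ → A) {n : ℕ} (h : n < w.length) :
    wcat w y n = wcat w z n := by
  simp [wcat, h]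

theorem wcat_cons_inj {a b : A} {v w : List A} {y z : ℕ → A}
    (h : wcat (a :: v) y = wcat (b :: w) z) : a = b ∧ wcat v y = wcat w z :=
  ⟨by simpa using congrFun h 0, funext fun n => by simpa using congrFun h (n + 1)⟩

theorem wcat_right_injective (w : List A) : Function.Injective (wcat w) := by
  induction w with
  | nil => intro y z h; simpa using h
  | cons a w ih => intro y z h; exact ih (wcat_cons_inj h).2

theorem exists_append_of_wcat_eq {v w : List A} {y z : ℕ → A} (h : wcat v y = wcat w z)
    (hl : v.length ≤ w.length) : ∃ d, w = v ++ d ∧ y = wcat d z := by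
  induction v generalizing w with
  | nil => exact ⟨w, by simp, by simpa using h⟩
  | cons a v ih =>
    cases w with
    | nil => simp at hl
    | cons b w =>
      obtain ⟨rfl, h'⟩ := wcat_cons_inj h
      obtain ⟨d, rfl, hd⟩ := ih h' (by simpa using hl)
      exact ⟨d, by simp, hd⟩

theorem exists_wcat_eq (y : ℕ → A) (N : ℕ) : ∃ w z, w.length = N ∧ y = wcat w z := by
  induction N generalizing y with
  | zero => exact ⟨[], y, by simp⟩
  | succ N ih =>
    obtain ⟨w, z, hw, h⟩ := ih fun n => y (n + 1)
    refine ⟨y 0 :: w, z, by simp [hw], funext fun n => ?_⟩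
    cases n with
    | zero => simp
    | succ n => simpa using congrFun h n

theorem mem_lang_of_wcat_mem {Xs : Set (ℕ → A)} {w : List A} {y : ℕ → A} (h : wcat w y ∈ Xs) :
    w ∈ lang Xs :=
  Or.inr ⟨_, h, 0, fun i => by simp [wcat]⟩

theorem mem_subshift_of_wcat_mem {Forb : Set (List A)} {w : List A} {y : ℕ → A}
    (h : wcat w y ∈ subshift Forb) : y ∈ subshift Forb := by
  rintro u hu ⟨n, hn⟩
  refine h u hu ⟨w.length + n, fun i => ?_⟩
  rw [← hn i, wcat_of_length_le _ _ (by omega)]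
  congr 1
  omega

/-- A sequence outside a subshift has a prefix none of whose continuations is in the subshift. -/
theorem exists_forall_notMem_subshift {Forb : Set (List A)} {y : ℕ → A} (h : y ∉ subshift Forb) :
    ∃ N, ∀ z, (∀ n < N, z n = y n) → z ∉ subshift Forb := by
  simp only [subshift, Set.mem_ofPred_eq, not_forall, not_not] at h
  obtain ⟨w, hw, n, hn⟩ := h
  refine ⟨n + w.length, fun z hz hzX => hzX w hw ⟨n, fun i => ?_⟩⟩
  rw [hz _ (by omega), hn]

end Words

section FreeGroup

variable {A : Type*}

@[simp]
theorem fgw_append (v w : List A) : fgw (v ++ w) = fgw v * fgw w := by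
  simp [fgw]

theorem fgw_eq_mk (w : List A) : fgw w = FreeGroup.mk (w.map fun a => (a, true)) := by
  induction w with
  | nil => rfl
  | cons a w ih =>
    simp only [fgw, List.map_cons, List.prod_cons] at ih ⊢
    rw [ih]
    rfl

theorem isReduced_of_noCommonLast {v w : List A} (h : NoCommonLast v w) :
    FreeGroup.IsReduced (v.map (fun a => (a, true)) ++ w.reverse.map fun a => (a, false)) := by
  refine List.isChain_append.2 ⟨?_, ?_, ?_⟩
  · rw [List.isChain_map]
    exact (List.pairwise_of_forall fun _ _ _ => rfl).isChain
  · rw [List.isChain_map]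
    exact (List.pairwise_of_forall fun _ _ _ => rfl).isChain
  · intro x hx y hy hxy
    simp only [List.getLast?_map, List.head?_map, List.head?_reverse, Option.mem_def,
      Option.map_eq_some_iff] at hx hy
    obtain ⟨a, ha, rfl⟩ := hx
    obtain ⟨b, hb, rfl⟩ := hy
    obtain rfl : a = b := hxy
    exact absurd hb (h a ha)

theorem fgw_mul_inv_eq_mk (v w : List A) : fgw v * (fgw w)⁻¹ =
    FreeGroup.mk (v.map (fun a => (a, true)) ++ w.reverse.map fun a => (a, false)) := by
  rw [fgw_eq_mk, fgw_eq_mk, FreeGroup.inv_mk, FreeGroup.mul_mk]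
  simp [FreeGroup.invRev, Function.comp_def]

theorem eq_of_noCommonLast {v w v' w' : List A} (h : NoCommonLast v w) (h' : NoCommonLast v' w')
    (he : fgw v * (fgw w)⁻¹ = fgw v' * (fgw w')⁻¹) : v = v' ∧ w = w' := by
  classical
  rw [fgw_mul_inv_eq_mk, fgw_mul_inv_eq_mk] at he
  have key := FreeGroup.reduce.sound he
  rw [(isReduced_of_noCommonLast h).reduce_eq, (isReduced_of_noCommonLast h').reduce_eq] at key
  constructor
  · have := congrArg (fun l => (l.filter fun p => p.2).map Prod.fst) key
    simpa [List.filter_map, Function.comp_def] using this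
  · have := congrArg (fun l => (l.filter fun p => !p.2).map Prod.fst) key
    simpa [List.filter_map, Function.comp_def] using this

theorem exists_noCommonLast (v w : List A) :
    ∃ v₀ w₀ e, v = v₀ ++ e ∧ w = w₀ ++ e ∧ NoCommonLast v₀ w₀ := by
  induction v using List.reverseRecOn generalizing w with
  | nil => exact ⟨[], w, [], by simp [NoCommonLast]⟩
  | append_singleton v a ih =>
    by_cases hw : w.getLast? = some a
    · obtain ⟨w, rfl⟩ := List.getLast?_eq_some_iff.1 hw
      obtain ⟨v₀, w₀, e, rfl, rfl, h⟩ := ih w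
      exact ⟨v₀, w₀, e ++ [a], by simp, by simp, h⟩
    · refine ⟨v ++ [a], w, [], by simp, by simp, fun b hb => ?_⟩
      simp only [List.getLast?_append, List.getLast?_singleton] at hb
      simp at hb
      exact hb ▸ hw

theorem eq_append_of_noCommonLast {v w v' w' : List A} (h : NoCommonLast v w)
    (he : fgw v * (fgw w)⁻¹ = fgw v' * (fgw w')⁻¹) : ∃ e, v' = v ++ e ∧ w' = w ++ e := by
  obtain ⟨v₀, w₀, e, rfl, rfl, h₀⟩ := exists_noCommonLast v' w'
  obtain ⟨rfl, rfl⟩ := eq_of_noCommonLast h h₀ (by simpa [mul_assoc] using he)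
  exact ⟨e, rfl, rfl⟩

theorem fgw_injective : Function.Injective (fgw : List A → FreeGroup A) := fun v w h =>
  (eq_of_noCommonLast (w := []) (w' := []) (fun _ _ => by simp) (fun _ _ => by simp)
    (by simp [h])).1

end FreeGroup

section Xi

variable {A : Type*} {Xs : Set (ℕ → A)}

theorem mem_xiSet_iff {x : ℕ → A} {g : FreeGroup A} : g ∈ xiSet Xs x ↔
    ∃ v w y, g = fgw w * (fgw v)⁻¹ ∧ x = wcat w y ∧ wcat w y ∈ Xs ∧ wcat v y ∈ Xs := by
  constructor
  · rintro ⟨v, -, w, -, rfl, y, rfl, hw, hv⟩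
    exact ⟨v, w, y, rfl, rfl, hw, hv⟩
  · rintro ⟨v, w, y, rfl, rfl, hw, hv⟩
    exact ⟨v, mem_lang_of_wcat_mem hv, w, mem_lang_of_wcat_mem hw, rfl, y, rfl, hw, hv⟩

theorem fgw_mul_inv_mem_xiSet_iff {v w : List A} {y : ℕ → A} (hw : wcat w y ∈ Xs) :
    fgw w * (fgw v)⁻¹ ∈ xiSet Xs (wcat w y) ↔ wcat v y ∈ Xs := by
  refine ⟨fun h => ?_, fun hv => mem_xiSet_iff.2 ⟨v, w, y, rfl, rfl, hw, hv⟩⟩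
  obtain ⟨v', w', y', hg, hx, -, hv'⟩ := mem_xiSet_iff.1 h
  rcases le_total w.length w'.length with hl | hl
  · obtain ⟨d, rfl, rfl⟩ := exists_append_of_wcat_eq hx hl
    have : v' = v ++ d := fgw_injective <| by
      rw [fgw_append, mul_assoc, mul_right_inj] at hg
      rw [fgw_append, ← inv_mul_eq_iff_eq_mul, hg, inv_mul_cancel_right]
    rwa [← wcat_append, ← this]
  · obtain ⟨d, rfl, rfl⟩ := exists_append_of_wcat_eq hx.symm hl
    have : v = v' ++ d := fgw_injective <| by
      rw [fgw_append, mul_assoc, mul_right_inj] at hg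
      rw [fgw_append, ← inv_mul_eq_iff_eq_mul, ← hg, inv_mul_cancel_right]
    rwa [this, wcat_append]

theorem mul_mem_xiSet_of_mem {v w : List A} {y : ℕ → A} {h : FreeGroup A} (hv : wcat v y ∈ Xs)
    (hh : h ∈ xiSet Xs (wcat w y)) : fgw v * (fgw w)⁻¹ * h ∈ xiSet Xs (wcat v y) := by
  obtain ⟨c, b, u, rfl, hx, hb, hc⟩ := mem_xiSet_iff.1 hh
  rcases le_total w.length b.length with hl | hl
  · obtain ⟨d, rfl, rfl⟩ := exists_append_of_wcat_eq hx hl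
    refine mem_xiSet_iff.2 ⟨c, v ++ d, u, ?_, by rw [wcat_append], by rwa [wcat_append], hc⟩
    simp only [fgw_append]; group
  · obtain ⟨d, rfl, rfl⟩ := exists_append_of_wcat_eq hx.symm hl
    refine mem_xiSet_iff.2 ⟨c ++ d, v, y, ?_, rfl, hv, by rwa [wcat_append]⟩
    simp only [fgw_append]; group

/-- The partial action moves `ξ_{wy}` to `ξ_{vy}`. -/
theorem mul_mem_xiSet_iff {v w : List A} {y : ℕ → A} {h : FreeGroup A} (hv : wcat v y ∈ Xs)
    (hw : wcat w y ∈ Xs) :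
    fgw v * (fgw w)⁻¹ * h ∈ xiSet Xs (wcat v y) ↔ h ∈ xiSet Xs (wcat w y) := by
  refine ⟨fun hh => ?_, mul_mem_xiSet_of_mem hv⟩
  have := mul_mem_xiSet_of_mem hw hh
  rwa [show fgw w * (fgw v)⁻¹ * (fgw v * (fgw w)⁻¹ * h) = h by group] at this

theorem exists_wcat_of_mem_xiSet {v w : List A} {x : ℕ → A} (hvw : NoCommonLast w v)
    (h : fgw w * (fgw v)⁻¹ ∈ xiSet Xs x) :
    ∃ y, x = wcat w y ∧ wcat w y ∈ Xs ∧ wcat v y ∈ Xs := by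
  obtain ⟨v', w', y, he, rfl, hw, hv⟩ := mem_xiSet_iff.1 h
  obtain ⟨e, rfl, rfl⟩ := eq_append_of_noCommonLast hvw he
  simp only [wcat_append] at *
  exact ⟨wcat e y, rfl, hw, hv⟩

@[simp]
theorem xiB_eq_true_iff {x : ℕ → A} {g : FreeGroup A} : xiB Xs x g = true ↔ g ∈ xiSet Xs x := by
  simp [xiB]

theorem xiB_apply_eq_iff {x y : ℕ → A} {g h : FreeGroup A} :
    xiB Xs x g = xiB Xs y h ↔ (g ∈ xiSet Xs x ↔ h ∈ xiSet Xs y) := by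
  rw [Bool.eq_iff_iff, xiB_eq_true_iff, xiB_eq_true_iff]

/-- Whether `h` belongs to `ξ_y` is controlled by a long enough prefix `δ` of `y` together with
one word that may replace `δ` in front of the remaining tail. -/
theorem exists_forall_mem_xiSet_iff {Forb : Set (List A)} {y : ℕ → A} (hy : y ∈ subshift Forb)
    (h : FreeGroup A) : ∃ N, ∀ δ z, N ≤ δ.length → y = wcat δ z →
      ∃ β, wcat β z ∈ subshift Forb ∧
        ∀ u, wcat δ u ∈ subshift Forb → wcat β u ∈ subshift Forb →
          (h ∈ xiSet (subshift Forb) (wcat δ u) ↔ h ∈ xiSet (subshift Forb) y) := by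
  by_cases hmem : h ∈ xiSet (subshift Forb) y
  · obtain ⟨c, b, u, rfl, rfl, hb, hc⟩ := mem_xiSet_iff.1 hmem
    refine ⟨b.length, fun δ z hl hδ => ?_⟩
    obtain ⟨d, rfl, rfl⟩ := exists_append_of_wcat_eq hδ hl
    refine ⟨c ++ d, by rwa [wcat_append], fun u hδu hβu => ?_⟩
    rw [wcat_append] at hδu hβu ⊢
    exact iff_of_true ((fgw_mul_inv_mem_xiSet_iff hδu).2 hβu) hmem
  suffices H : ∃ N, ∀ δ z u, N ≤ δ.length → y = wcat δ z → wcat δ u ∈ subshift Forb →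
      h ∉ xiSet (subshift Forb) (wcat δ u) by
    obtain ⟨N, hN⟩ := H
    exact ⟨N, fun δ z hl hδ => ⟨δ, hδ ▸ hy, fun u hu _ => iff_of_false (hN δ z u hl hδ hu) hmem⟩⟩
  by_cases hform : ∃ a c : List A, h = fgw a * (fgw c)⁻¹
  swap
  · refine ⟨0, fun δ z u _ _ _ hh => hform ?_⟩
    obtain ⟨c, a, -, rfl, -⟩ := mem_xiSet_iff.1 hh
    exact ⟨a, c, rfl⟩
  obtain ⟨a, c, hnc, rfl⟩ : ∃ a c : List A, NoCommonLast a c ∧ h = fgw a * (fgw c)⁻¹ := by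
    obtain ⟨a', c', rfl⟩ := hform
    obtain ⟨a, c, e, rfl, rfl, hnc⟩ := exists_noCommonLast a' c'
    exact ⟨a, c, hnc, by simp only [fgw_append]; group⟩
  by_cases hpre : ∃ z, y = wcat a z
  swap
  · refine ⟨a.length, fun δ z u hl hδ hu hh => hpre ?_⟩
    obtain ⟨t, ht, -⟩ := exists_wcat_of_mem_xiSet hnc hh
    obtain ⟨d, rfl, -⟩ := exists_append_of_wcat_eq ht.symm hl
    exact ⟨wcat d z, by rw [hδ, wcat_append]⟩
  obtain ⟨t, rfl⟩ := hpre
  rw [fgw_mul_inv_mem_xiSet_iff hy] at hmem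
  obtain ⟨M, hM⟩ := exists_forall_notMem_subshift hmem
  refine ⟨a.length + M, fun δ z u hl hδ hu hh => ?_⟩
  obtain ⟨d, rfl, rfl⟩ := exists_append_of_wcat_eq hδ (by omega)
  rw [wcat_append] at hu hh
  rw [fgw_mul_inv_mem_xiSet_iff hu] at hh
  refine hM _ (fun n hn => ?_) hh
  rw [← wcat_append, ← wcat_append]
  simp only [List.length_append] at hl
  exact wcat_congr_left _ _ _ (by simp only [List.length_append]; omega)

end Xi

section BoolCube

variable {ι : Type*}

theorem mem_closure_pi_bool_iff {S : Set (ι → Bool)} {f : ι → Bool} :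
    f ∈ closure S ↔ ∀ I : Finset ι, ∃ g ∈ S, ∀ i ∈ I, g i = f i := by
  rw [mem_closure_iff]
  constructor
  · intro h I
    obtain ⟨g, hg, hgS⟩ := h ((I : Set ι).pi fun i => {f i})
      (isOpen_set_pi I.finite_toSet fun _ _ => isOpen_discrete _) fun i _ => rfl
    exact ⟨g, hgS, fun i hi => hg i hi⟩
  · intro h U hU hf
    obtain ⟨I, u, hu, hIU⟩ := isOpen_pi_iff.1 hU f hf
    obtain ⟨g, hgS, hg⟩ := h I
    exact ⟨g, hIU fun i hi => hg i hi ▸ (hu i hi).2, hgS⟩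

theorem tendsto_pi_bool_iff {u : ℕ → ι → Bool} {f : ι → Bool} :
    Tendsto u atTop (𝓝 f) ↔ ∀ i, ∀ᶠ n in atTop, u n i = f i := by
  simp only [tendsto_pi_nhds, nhds_discrete, tendsto_pure]

end BoolCube


section Minimality

variable {A : Type*} [Countable A] {Forb : Set (List A)}

/-- Sequential cofinality of a set of sequences. -/
def SeqCofinal (Xs : Set (ℕ → A)) : Prop :=
  ∀ Bf : Finset (List A), (∀ β ∈ Bf, β ∈ lang Xs) → (⋂ β ∈ Bf, Cab Xs β []).Nonempty →
    ∀ x : ℕ → ℕ → A, (∀ n : ℕ, x n ∈ Xs) →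
      ∃ α ∈ lang Xs, ∃ γ ∈ lang Xs, ∃ φ : ℕ → ℕ, StrictMono φ ∧
        ∀ k : ℕ, ∀ β ∈ Bf, x (φ k) ∈ Cab Xs (β ++ γ) α

/-- The orbit of `ξ` under the partial action by left translation. -/
def orbitSet (ξ : FreeGroup A → Bool) : Set (FreeGroup A → Bool) :=
  {η | ∃ g : FreeGroup A, ξ g⁻¹ = true ∧ η = fun h => ξ (g⁻¹ * h)}

theorem seqCofinal_of_minimal {Xs : Set (ℕ → A)}
    (hmin : ∀ ξ ∈ Omega Xs, Omega Xs ⊆ closure (orbitSet ξ)) : SeqCofinal Xs := by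
  classical
  rintro Bf - ⟨y, hy⟩ x hx
  rcases Bf.eq_empty_or_nonempty with rfl | ⟨β₀, hβ₀⟩
  · exact ⟨[], Or.inl rfl, [], Or.inl rfl, id, strictMono_id, by simp⟩
  have hyB : ∀ β ∈ Bf, y ∈ Xs ∧ wcat β y ∈ Xs := by
    intro β hβ
    obtain ⟨y', rfl, h₁, h₂⟩ := Set.mem_iInter₂.1 hy β hβ
    rw [wcat_nil] at h₁ ⊢
    exact ⟨h₁, h₂⟩
  obtain ⟨ξ, φ, hφ, hlim⟩ := CompactSpace.tendsto_subseq fun n => xiB Xs (x n)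
  have hξ : ξ ∈ Omega Xs :=
    mem_closure_of_tendsto hlim (Eventually.of_forall fun n => ⟨_, hx _, rfl⟩)
  obtain ⟨_, ⟨g, hg, rfl⟩, hgB⟩ := mem_closure_pi_bool_iff.1
    (hmin ξ hξ (subset_closure ⟨y, (hyB β₀ hβ₀).1, rfl⟩)) (Bf.image fun β => (fgw β)⁻¹)
  have hgB' : ∀ β ∈ Bf, ξ (g⁻¹ * (fgw β)⁻¹) = true := by
    intro β hβ
    refine (hgB _ (Finset.mem_image_of_mem _ hβ)).trans (xiB_eq_true_iff.2 (mem_xiSet_iff.2 ?_))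
    exact ⟨β, [], y, by simp [fgw], by simp, by simpa using (hyB β hβ).1, (hyB β hβ).2⟩
  rw [tendsto_pi_bool_iff] at hlim
  have hev : ∀ᶠ n in atTop, g⁻¹ ∈ xiSet Xs (x (φ n)) ∧
      ∀ β ∈ Bf, g⁻¹ * (fgw β)⁻¹ ∈ xiSet Xs (x (φ n)) := by
    refine Eventually.and ?_ ((Finset.eventually_all Bf).2 fun β hβ => ?_)
    · filter_upwards [hlim g⁻¹] with n hn
      exact xiB_eq_true_iff.1 (hn.trans hg)
    · filter_upwards [hlim (g⁻¹ * (fgw β)⁻¹)] with n hn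
      exact xiB_eq_true_iff.1 (hn.trans (hgB' β hβ))
  obtain ⟨N, hN⟩ := eventually_atTop.1 hev
  obtain ⟨a, c, hac, hgac⟩ : ∃ a c : List A, NoCommonLast a c ∧ g⁻¹ = fgw a * (fgw c)⁻¹ := by
    obtain ⟨c', a', -, he, -⟩ := mem_xiSet_iff.1 (hN N le_rfl).1
    obtain ⟨a, c, e, rfl, rfl, hac⟩ := exists_noCommonLast a' c'
    exact ⟨a, c, hac, by rw [he]; simp only [fgw_append]; group⟩
  have key : ∀ n ≥ N, ∃ z, x (φ n) = wcat a z ∧ wcat a z ∈ Xs ∧ wcat c z ∈ Xs ∧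
      ∀ β ∈ Bf, wcat (β ++ c) z ∈ Xs := by
    intro n hn
    obtain ⟨h₁, h₂⟩ := hN n hn
    rw [hgac] at h₁ h₂
    obtain ⟨z, hz, ha, hc⟩ := exists_wcat_of_mem_xiSet hac h₁
    refine ⟨z, hz, ha, hc, fun β hβ => (fgw_mul_inv_mem_xiSet_iff ha).1 ?_⟩
    rw [← hz]
    simpa [mul_assoc] using h₂ β hβ
  obtain ⟨z, -, ha, hc, -⟩ := key N le_rfl
  refine ⟨a, mem_lang_of_wcat_mem ha, c, mem_lang_of_wcat_mem hc, fun k => φ (N + k),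
    fun i j hij => hφ (by omega), fun k β hβ => ?_⟩
  obtain ⟨z, hz, ha, -, hB⟩ := key (N + k) (by omega)
  exact ⟨z, hz, ha, hB β hβ⟩

theorem minimal_of_seqCofinal (hcof : SeqCofinal (subshift Forb)) {ξ : FreeGroup A → Bool}
    (hξ : ξ ∈ Omega (subshift Forb)) : Omega (subshift Forb) ⊆ closure (orbitSet ξ) := by
  classical
  refine closure_minimal ?_ isClosed_closure
  rintro _ ⟨y, hy, rfl⟩
  refine mem_closure_pi_bool_iff.2 fun I => ?_
  obtain ⟨s, hs, hlim⟩ := mem_closure_iff_seq_limit.1 hξ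
  choose x hx hsx using hs
  obtain rfl : s = fun n => xiB (subshift Forb) (x n) := funext hsx
  rw [tendsto_pi_bool_iff] at hlim
  choose N hN using exists_forall_mem_xiSet_iff hy
  obtain ⟨δ, z, hδl, rfl⟩ := exists_wcat_eq y (I.sup N)
  have hI : ∀ h ∈ I, N h ≤ δ.length := fun h hh => hδl ▸ Finset.le_sup hh
  choose! β hβ hβI using fun h hh => hN h δ z (hI h hh) rfl
  have hB : ∀ b ∈ insert δ (I.image β), wcat b z ∈ subshift Forb := by
    simpa [Finset.forall_mem_insert, hy] using hβ
  have hz := mem_subshift_of_wcat_mem hy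
  obtain ⟨α, -, γ, -, φ, hφ, hmem⟩ := hcof (insert δ (I.image β))
    (fun b hb => mem_lang_of_wcat_mem (hB b hb))
    ⟨z, Set.mem_iInter₂.2 fun b hb => ⟨z, by simp, by simpa using hz, hB b hb⟩⟩ x hx
  have key : ∀ k, ∃ u, x (φ k) = wcat α u ∧ wcat α u ∈ subshift Forb ∧
      ∀ b ∈ insert δ (I.image β), wcat b (wcat γ u) ∈ subshift Forb := by
    intro k
    obtain ⟨u, hu, hα, -⟩ := hmem k δ (Finset.mem_insert_self _ _)
    refine ⟨u, hu, hα, fun b hb => ?_⟩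
    obtain ⟨u', hu', -, hb'⟩ := hmem k b hb
    rwa [wcat_right_injective α (hu.symm.trans hu'), ← wcat_append]
  have hlim' : ∀ g, ∃ k, ξ g = xiB (subshift Forb) (x (φ k)) g := fun g =>
    let ⟨k, hk⟩ := (hφ.tendsto_atTop.eventually (hlim g)).exists
    ⟨k, hk.symm⟩
  have hinv : (fgw (δ ++ γ) * (fgw α)⁻¹)⁻¹ = fgw α * (fgw (δ ++ γ))⁻¹ := by group
  refine ⟨_, ⟨fgw (δ ++ γ) * (fgw α)⁻¹, ?_, rfl⟩, fun h hh => ?_⟩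
  · obtain ⟨k, hk⟩ := hlim' (fgw (δ ++ γ) * (fgw α)⁻¹)⁻¹
    obtain ⟨u, hu, hα, hb⟩ := key k
    rw [hk, xiB_eq_true_iff, hinv, hu, fgw_mul_inv_mem_xiSet_iff hα, wcat_append]
    exact hb δ (Finset.mem_insert_self _ _)
  · obtain ⟨k, hk⟩ := hlim' ((fgw (δ ++ γ) * (fgw α)⁻¹)⁻¹ * h)
    obtain ⟨u, hu, hα, hb⟩ := key k
    have hδ := hb δ (Finset.mem_insert_self _ _)
    have hβu := hb (β h) (Finset.mem_insert_of_mem (Finset.mem_image_of_mem _ hh))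
    rw [hk, xiB_apply_eq_iff, hinv, hu, mul_mem_xiSet_iff hα (by rwa [wcat_append]), wcat_append]
    exact hβI h hh _ hδ hβu

end Minimality

/-- Theorem 5.15 for a countable alphabet: the partial action of `𝔽` on `Ω` by left
translation is minimal (every orbit is dense in `Ω`) if and only if the subshift is
sequentially cofinal: for every finite `B ⊆ L_X` with `F_B ≠ ∅` and every sequence
`(x_n)` in `X` there are `α, γ ∈ L_X` and a subsequence `(x_{n_k})` with
`x_{n_k} ∈ C(βγ, α)` for all `k` and all `β ∈ B`. -/
theorem stmt_16 {A : Type*} [Nonempty A] [Countable A] (Forb : Set (List A)) :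
    (∀ ξ ∈ Omega (subshift Forb),
      Omega (subshift Forb) ⊆
        closure {η : FreeGroup A → Bool |
          ∃ g : FreeGroup A, ξ g⁻¹ = true ∧ η = fun h => ξ (g⁻¹ * h)}) ↔
    (∀ Bf : Finset (List A), (∀ β ∈ Bf, β ∈ lang (subshift Forb)) →
      (⋂ β ∈ Bf, Cab (subshift Forb) β []).Nonempty →
      ∀ x : ℕ → ℕ → A, (∀ n : ℕ, x n ∈ subshift Forb) →
        ∃ α ∈ lang (subshift Forb), ∃ γ ∈ lang (subshift Forb),
          ∃ φ : ℕ → ℕ, StrictMono φ ∧ ∀ k : ℕ, ∀ β ∈ Bf,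
            x (φ k) ∈ Cab (subshift Forb) (β ++ γ) α) := by
  exact ⟨seqCofinal_of_minimal, fun h _ => minimal_of_seqCofinal h⟩
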